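/- arXiv:0910.5944 — 2 statements merged into one kernel-verified Lean document; each statement's English description precedes it below -/
import Mathlib

section
/- Let n ≥ 1 and M ≥ 1 be integers, let m^{(1)}, …, m^{(M)} ∈ ℤⁿ and ε₁, …, ε_M ∈ ℤ satisfy ∑_{a=1}^{M} ε_a m_i^{(a)} m_j^{(a)} m_k^{(a)} = 0, ∑_{a=1}^{M} ε_a m_i^{(a)} m_j^{(a)} = 0, and ∑_{a=1}^{M} ε_a m_i^{(a)} = 0 for all 1 ≤ i, j, k ≤ n. Let ω₁, ω₂, ω₃ ∈ ℂ ∖ {0} with Im(ω₃/ω₂) > 0. Then the q-certificates are modular invariant: for every 1 ≤ i ≤ n and every u ∈ ℂⁿ at which all theta factors occurring with negative exponent are nonzero, writing ⟨m,u⟩ = ∑_{j=1}^{n} m_j u_j, one has ∏_{a=1}^{M} θ(e^{−2πi⟨m^{(a)},u⟩/ω₃}; e^{−2πiω₂/ω₃}; e^{−2πiω₁/ω₃})_{m_i^{(a)}}^{ε_a} = ∏_{a=1}^{M} θ(e^{2πi⟨m^{(a)},u⟩/ω₂}; e^{2πiω₃/ω₂}; e^{2πiω₁/ω₂})_{m_i^{(a)}}^{ε_a}.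 -/
open scoped BigOperators

/-- The infinite q-Pochhammer symbol `(x;p)_∞ = ∏_{j≥0} (1 - x p^j)`. -/
noncomputable def pochInf (x p : ℂ) : ℂ := ∏' j : ℕ, (1 - x * p ^ j)

/-- The theta function `θ(x;p) = (x;p)_∞ (p x⁻¹;p)_∞`. -/
noncomputable def theta (x p : ℂ) : ℂ := pochInf x p * pochInf (p * x⁻¹) p

/-- The elliptic shifted factorial `θ(x;p;q)_n` for `n : ℤ`. -/
noncomputable def thetaPoch (x p q : ℂ) (n : ℤ) : ℂ :=
  if 0 ≤ n then ∏ j ∈ Finset.range n.toNat, theta (x * q ^ j) p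
  else ∏ j ∈ Finset.range (-n).toNat, (theta (x * q ^ (-((j : ℤ) + 1))) p)⁻¹

theorem summable_aux (x : ℂ) {p : ℂ} (hp : ‖p‖ < 1) : Summable (fun j : ℕ => ‖-(x * p ^ j)‖) := by
  simp only [norm_neg, norm_mul, norm_pow]
  exact (summable_geometric_of_lt_one (norm_nonneg _) hp).mul_left _

theorem pochInf_ne_zero {x p : ℂ} (hp : ‖p‖ < 1) (h : ∀ j : ℕ, x * p ^ j ≠ 1) :
    pochInf x p ≠ 0 := by
  unfold pochInf
  simp_rw [sub_eq_add_neg]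
  refine tprod_one_add_ne_zero_of_summable ?_ (summable_aux x hp)
  intro i hi
  apply h i
  linear_combination -hi

theorem pochInf_step (x : ℂ) {p : ℂ} (hp : ‖p‖ < 1) :
    pochInf x p = (1 - x) * pochInf (p * x) p := by
  unfold pochInf
  have hm : Multipliable (fun j : ℕ => 1 - x * p ^ (j + 1)) := by
    have := multipliable_one_add_of_summable (summable_aux (p * x) hp)
    refine this.congr ?_
    intro b
    ring
  have h2 : (∏' j : ℕ, (1 - p * x * p ^ j)) = ∏' j : ℕ, (1 - x * p ^ (j + 1)) :=
    tprod_congr fun j => by ring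
  rw [h2]
  have h3 := tprod_eq_zero_mul' (f := fun j : ℕ => 1 - x * p ^ j) hm
  rw [h3, pow_zero, mul_one]

theorem pochInf_differentiable {p : ℂ} (hp : ‖p‖ < 1) : Differentiable ℂ (fun x => pochInf x p) := by
  intro x₀
  have h1 : HasProdLocallyUniformlyOn (fun (n : ℕ) (x : ℂ) => 1 + (-(x * p ^ n)))
      (fun x => ∏' i : ℕ, (1 + (-(x * p ^ i)))) (Metric.ball x₀ 1) := by
    have hs : Summable (fun n : ℕ => (‖x₀‖ + 1) * ‖p‖ ^ n) :=
      (summable_geometric_of_lt_one (norm_nonneg _) hp).mul_left _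
    refine hs.hasProdLocallyUniformlyOn_nat_one_add
      Metric.isOpen_ball ?_ ?_
    · refine Filter.Eventually.of_forall fun n x hx => ?_
      rw [norm_neg, norm_mul, norm_pow]
      gcongr
      rw [Metric.mem_ball, dist_eq_norm] at hx
      have : ‖x‖ ≤ ‖x₀‖ + ‖x - x₀‖ := by
        simpa using norm_add_le x₀ (x - x₀)
      linarith
    · intro n
      fun_prop
  have h2 : DifferentiableOn ℂ (fun x => ∏' i : ℕ, (1 + (-(x * p ^ i)))) (Metric.ball x₀ 1) :=
    h1.differentiableOn
      (.of_forall fun _ ↦ by simpa [Finset.prod_fn] using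
        DifferentiableOn.finsetProd (fun _ _ ↦ by fun_prop)) Metric.isOpen_ball
  have h3 := h2.differentiableAt (Metric.isOpen_ball.mem_nhds (Metric.mem_ball_self one_pos))
  simpa [pochInf, sub_eq_add_neg] using h3

theorem theta_step {x p : ℂ} (hp : ‖p‖ < 1) (hp0 : p ≠ 0) (hx : x ≠ 0) :
    theta (x * p) p = -x⁻¹ * theta x p := by
  unfold theta
  have h1 : p * (x * p)⁻¹ = x⁻¹ := by field_simp
  rw [h1, pochInf_step x hp, pochInf_step x⁻¹ hp, mul_comm p x]
  field_simp
  ring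

/-- additive version of theta -/
noncomputable def TT (w w' u : ℂ) : ℂ :=
  theta (Complex.exp (2 * (Real.pi : ℂ) * Complex.I * u / w))
    (Complex.exp (2 * (Real.pi : ℂ) * Complex.I * w' / w))

theorem p_norm {w w' : ℂ} (h : 0 < (w' / w).im) :
    ‖Complex.exp (2 * (Real.pi : ℂ) * Complex.I * w' / w)‖ < 1 := by
  rw [Complex.norm_exp, Real.exp_lt_one_iff]
  have : 2 * (Real.pi : ℂ) * Complex.I * w' / w = ((2 * Real.pi : ℝ) : ℂ) * (Complex.I * (w' / w)) := by
    push_cast; ring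
  rw [this, Complex.re_ofReal_mul, Complex.I_mul_re]
  have := Real.pi_pos
  nlinarith

theorem TT_add_w {w w' : ℂ} (hw : w ≠ 0) (u : ℂ) : TT w w' (u + w) = TT w w' u := by
  unfold TT
  congr 1
  rw [show 2 * (Real.pi : ℂ) * Complex.I * (u + w) / w =
    2 * (Real.pi : ℂ) * Complex.I * u / w + 2 * (Real.pi : ℂ) * Complex.I by field_simp]
  rw [Complex.exp_add, Complex.exp_two_pi_mul_I, mul_one]

theorem TT_add_w' {w w' : ℂ} (h : 0 < (w' / w).im) (u : ℂ) :
    TT w w' (u + w') = -Complex.exp (-(2 * (Real.pi : ℂ) * Complex.I * u / w)) * TT w w' u := by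
  unfold TT
  rw [Complex.exp_neg, ← theta_step (p_norm h) (Complex.exp_ne_zero _) (Complex.exp_ne_zero _),
    ← Complex.exp_add]
  congr 2
  ring

theorem TT_differentiable {w w' : ℂ} (h : 0 < (w' / w).im) : Differentiable ℂ (TT w w') := by
  have hd := pochInf_differentiable (p_norm h)
  unfold TT theta
  refine Differentiable.mul (hd.comp (g := fun x => pochInf x _) (f := fun u : ℂ => Complex.exp (2 * (Real.pi : ℂ) * Complex.I * u / w)) (by fun_prop)) ?_
  refine (hd.comp (g := fun x => pochInf x _) (f := fun u : ℂ => Complex.exp (2 * (Real.pi : ℂ) * Complex.I * w' / w) * (Complex.exp (2 * (Real.pi : ℂ) * Complex.I * u / w))⁻¹) ?_)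
  simp_rw [← Complex.exp_neg]
  fun_prop

theorem TT_zero_lattice {w w' : ℂ} (hw : w ≠ 0) (h : 0 < (w' / w).im) (u : ℂ) (hu : TT w w' u = 0) :
    ∃ a b : ℤ, u = a * w + b * w' := by
  have hpi : (2 * (Real.pi : ℂ) * Complex.I) ≠ 0 := Complex.two_pi_I_ne_zero
  by_contra! hc
  unfold TT theta at hu
  rcases mul_eq_zero.1 hu with h0 | h0
  · refine pochInf_ne_zero (p_norm h) (fun j hj => ?_) h0
    rw [← Complex.exp_nat_mul, ← Complex.exp_add, Complex.exp_eq_one_iff] at hj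
    obtain ⟨k, hk⟩ := hj
    apply hc k (-j)
    field_simp at hk
    push_cast
    linear_combination hk
  · refine pochInf_ne_zero (p_norm h) (fun j hj => ?_) h0
    rw [← Complex.exp_neg, ← Complex.exp_nat_mul, ← Complex.exp_add, ← Complex.exp_add, Complex.exp_eq_one_iff] at hj
    obtain ⟨k, hk⟩ := hj
    apply hc (-k) (j+1)
    field_simp at hk
    push_cast
    linear_combination -hk

theorem TT_zero (w w' : ℂ) (h : 0 < (w' / w).im) : TT w w' 0 = 0 := by
  unfold TT theta
  rw [pochInf_step _ (p_norm h)]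
  simp

theorem TT_deriv {w w' : ℂ} (hw : w ≠ 0) (h : 0 < (w' / w).im) :
    ∃ d : ℂ, d ≠ 0 ∧ HasDerivAt (TT w w') d 0 := by
  set p := Complex.exp (2 * (Real.pi : ℂ) * Complex.I * w' / w) with hp
  have hpn : ‖p‖ < 1 := p_norm h
  have hd := pochInf_differentiable hpn
  set e : ℂ → ℂ := fun u => Complex.exp (2 * (Real.pi : ℂ) * Complex.I * u / w) with he
  let R : ℂ → ℂ := fun u => pochInf (p * e u) p * pochInf (p * (e u)⁻¹) p
  have hT : TT w w' = fun u => (1 - e u) * R u := by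
    ext u
    simp only [TT, theta, R]
    rw [pochInf_step _ hpn]
    ring
  have hR : Differentiable ℂ R := by
    refine Differentiable.mul (hd.comp (g := fun x => pochInf x p) (f := fun u : ℂ => p * e u) (by fun_prop)) ?_
    refine (hd.comp (g := fun x => pochInf x _) (f := fun u : ℂ => p * (e u)⁻¹) ?_)
    simp_rw [he, ← Complex.exp_neg]
    fun_prop
  have e0 : e 0 = 1 := by simp [he]
  have hR0 : R 0 ≠ 0 := by
    have : pochInf p p ≠ 0 := by
      apply pochInf_ne_zero hpn
      intro j hj
      have h1 : ‖p ^ (j+1)‖ < 1 := by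
        rw [norm_pow]
        exact pow_lt_one₀ (norm_nonneg _) hpn (by omega)
      rw [pow_succ', hj] at h1
      simp at h1
    simp [R, e0, this]
  have hde : HasDerivAt e (2 * (Real.pi : ℂ) * Complex.I / w) 0 := by
    have h1 : HasDerivAt (fun u : ℂ => 2 * (Real.pi : ℂ) * Complex.I * u / w) (2 * (Real.pi : ℂ) * Complex.I / w) 0 := by
      simpa using ((hasDerivAt_id (0:ℂ)).const_mul (2 * (Real.pi : ℂ) * Complex.I)).div_const w
    have h2 := h1.cexp
    simpa using h2
  refine ⟨_, ?_, by rw [hT]; exact (hde.const_sub 1).mul (hR 0).hasDerivAt⟩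
  rw [e0]
  simp only [sub_self, zero_mul, add_zero]
  exact mul_ne_zero (neg_ne_zero.2 (div_ne_zero Complex.two_pi_I_ne_zero hw)) hR0

/-- `l` is a common quasi-period of `F` and `G`. -/
def QP (F G : ℂ → ℂ) (l : ℂ) : Prop := ∀ u, ∃ μ : ℂ, μ ≠ 0 ∧ F (u + l) = μ * F u ∧ G (u + l) = μ * G u

theorem QP.add {F G : ℂ → ℂ} {l l' : ℂ} (h : QP F G l) (h' : QP F G l') : QP F G (l + l') := by
  intro u
  obtain ⟨μ, h0, h1, h2⟩ := h u
  obtain ⟨μ', h0', h1', h2'⟩ := h' (u + l)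
  refine ⟨μ' * μ, mul_ne_zero h0' h0, ?_, ?_⟩
  · rw [← add_assoc, h1', h1, mul_assoc]
  · rw [← add_assoc, h2', h2, mul_assoc]

theorem QP.neg {F G : ℂ → ℂ} {l : ℂ} (h : QP F G l) : QP F G (-l) := by
  intro u
  obtain ⟨μ, h0, h1, h2⟩ := h (u + -l)
  rw [neg_add_cancel_right] at h1 h2
  refine ⟨μ⁻¹, inv_ne_zero h0, ?_, ?_⟩
  · rw [h1, inv_mul_cancel_left₀ h0]
  · rw [h2, inv_mul_cancel_left₀ h0]

theorem QP.zero (F G : ℂ → ℂ) : QP F G 0 := fun u => ⟨1, one_ne_zero, by simp, by simp⟩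

theorem QP.int_mul {F G : ℂ → ℂ} {l : ℂ} (h : QP F G l) (a : ℤ) : QP F G (a * l) := by
  let S : AddSubgroup ℂ :=
    { carrier := {l | QP F G l}
      add_mem' := fun ha hb => QP.add ha hb
      zero_mem' := QP.zero F G
      neg_mem' := fun ha => QP.neg ha }
  have h1 : l ∈ S := h
  have h2 : a • l ∈ S := S.zsmul_mem h1 a
  rw [zsmul_eq_mul] at h2
  exact h2

open Classical in
theorem quot_const {w w' : ℂ} (hw : w ≠ 0) (him : 0 < (w' / w).im) {F G : ℂ → ℂ}
    (hF : Differentiable ℂ F) (hG : Differentiable ℂ G) (hF0 : F 0 = 0) (hG0 : G 0 = 0)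
    {dF dG : ℂ} (hdF : dF ≠ 0) (hdG : dG ≠ 0) (hF' : HasDerivAt F dF 0) (hG' : HasDerivAt G dG 0)
    (hz : ∀ u, G u = 0 → ∃ a b : ℤ, u = a * w + b * w')
    (h1 : QP F G w) (h2 : QP F G w') : ∃ c : ℂ, c ≠ 0 ∧ ∀ u, F u = c * G u := by
  have hper : ∀ a b : ℤ, QP F G (a * w + b * w') := fun a b => (h1.int_mul a).add (h2.int_mul b)
  let Q : ℂ → ℂ := fun u => if G u = 0 then dF / dG else F u / G u
  have hQp : ∀ l, QP F G l → ∀ u, Q (u + l) = Q u := by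
    intro l hl u
    obtain ⟨μ, h0, h1, h2⟩ := hl u
    simp only [Q, h1, h2, mul_eq_zero, h0, false_or]
    rw [mul_div_mul_left _ _ h0]
  have hQd : ∀ u, G u ≠ 0 → DifferentiableAt ℂ Q u := by
    intro u hu
    have : Q =ᶠ[nhds u] fun u => F u / G u := by
      filter_upwards [hG.continuous.continuousAt.eventually_ne hu] with v hv
      simp [Q, hv]
    exact ((hF u).div (hG u) hu).congr_of_eventuallyEq this
  have hev : ∀ᶠ z in nhdsWithin (0 : ℂ) {0}ᶜ, G z ≠ 0 := hG'.eventually_ne hdG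
  have hQ0 : DifferentiableAt ℂ Q 0 := by
    refine (Complex.analyticAt_of_differentiable_on_punctured_nhds_of_continuousAt
      (hev.mono hQd) ?_).differentiableAt
    rw [← continuousWithinAt_compl_self]
    unfold ContinuousWithinAt
    have hq0 : Q 0 = dF / dG := by simp [Q, hG0]
    rw [hq0]
    refine ((hasDerivAt_iff_tendsto_slope.1 hF').div (hasDerivAt_iff_tendsto_slope.1 hG') hdG).congr' ?_
    filter_upwards [hev, self_mem_nhdsWithin] with z hz hz0
    have hz0' : z ≠ 0 := hz0
    simp only [Q, hz, if_false, slope_def_field, hF0, hG0, sub_zero, Pi.div_apply]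
    field_simp
  have hQ : Differentiable ℂ Q := by
    intro u
    by_cases hu : G u = 0
    · obtain ⟨a, b, hab⟩ := hz u hu
      have hp := hQp _ (hper a b).neg
      have : Q = Q ∘ fun v => v + -(a * w + b * w') := by
        ext v
        exact (hp v).symm
      rw [this]
      refine DifferentiableAt.comp u ?_ (by fun_prop)
      rw [← hab, add_neg_cancel]
      exact hQ0
    · exact hQd u hu
  have hb : Bornology.IsBounded (Set.range Q) := by
    let f : ℝ × ℝ → ℂ := fun x => Q (x.1 * w + x.2 * w')
    have hf : Continuous f := hQ.continuous.comp (by fun_prop)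
    have hK : IsCompact (Set.Icc (0:ℝ) 1 ×ˢ Set.Icc (0:ℝ) 1) := isCompact_Icc.prod isCompact_Icc
    refine (hK.image hf).isBounded.subset ?_
    rintro _ ⟨u, rfl⟩
    let t : ℝ := (u / w).im / (w' / w).im
    let s : ℝ := (u / w - t * (w' / w)).re
    have hu : u = s * w + t * w' := by
      have h3 : u / w - t * (w' / w) = s := by
        apply Complex.ext
        · simp [s]
        · rw [Complex.sub_im, Complex.im_ofReal_mul, Complex.ofReal_im]
          simp only [t]
          field_simp
          ring
      field_simp at h3
      linear_combination h3
    refine ⟨(Int.fract s, Int.fract t), ⟨⟨Int.fract_nonneg _, (Int.fract_lt_one _).le⟩,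
      ⟨Int.fract_nonneg _, (Int.fract_lt_one _).le⟩⟩, ?_⟩
    simp only [f]
    rw [← hQp _ (hper ⌊s⌋ ⌊t⌋)]
    congr 1
    have hs : (s : ℂ) = ⌊s⌋ + (Int.fract s : ℝ) := by exact_mod_cast (Int.floor_add_fract s).symm
    have ht : (t : ℂ) = ⌊t⌋ + (Int.fract t : ℝ) := by exact_mod_cast (Int.floor_add_fract t).symm
    rw [hu]
    linear_combination -w * hs - w' * ht
  refine ⟨dF / dG, div_ne_zero hdF hdG, fun u => ?_⟩
  by_cases hu : G u = 0
  · obtain ⟨a, b, hab⟩ := hz u hu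
    obtain ⟨μ, -, h3, -⟩ := hper a b 0
    rw [hu, mul_zero, hab, ← zero_add (_ + _), h3, hF0, mul_zero]
  · have := hQ.apply_eq_apply_of_bounded hb u 0
    simp only [Q, hu, hG0, if_true, if_false] at this
    rw [← this, div_mul_cancel₀ _ hu]

/-- The quadratic exponent. -/
noncomputable def EE (w w' u : ℂ) : ℂ :=
  (Real.pi : ℂ) * Complex.I * (u ^ 2 / (w * w') - u / w - u / w')

theorem TT_modular {w w' : ℂ} (hw : w ≠ 0) (hw' : w' ≠ 0) (him : 0 < (w' / w).im) :
    ∃ c : ℂ, c ≠ 0 ∧ ∀ u, TT (-w') w u = c * (Complex.exp (EE w w' u) * TT w w' u) := by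
  have him' : 0 < (w / (-w')).im := by
    have : w / (-w') = -(w' / w)⁻¹ := by field_simp
    rw [this, Complex.neg_im, Complex.inv_im, neg_div, neg_neg]
    apply div_pos him
    rw [Complex.normSq_pos]
    exact div_ne_zero hw' hw
  obtain ⟨dF, hdF, hF'⟩ := TT_deriv (neg_ne_zero.2 hw') him'
  obtain ⟨dG, hdG, hG'⟩ := TT_deriv hw him
  have hEd : Differentiable ℂ (fun u => Complex.exp (EE w w' u)) := by
    unfold EE; fun_prop
  have hGz : TT w w' 0 = 0 := TT_zero w w' him
  refine quot_const hw him (TT_differentiable him') (hEd.mul (TT_differentiable him))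
    (TT_zero _ _ him') (by simp [hGz]) hdF (dG := dG) hdG hF' ?_ ?_ ?_ ?_
  · have := (hEd 0).hasDerivAt.mul hG'
    rw [hGz] at this
    have h0 : ∀ d : ℂ, d * 0 + Complex.exp (EE w w' 0) * dG = dG := by
      intro d
      simp [EE]
    rw [h0] at this
    exact this
  · intro u hu
    exact TT_zero_lattice hw him u (by simpa [Complex.exp_ne_zero] using hu)
  · intro u
    refine ⟨_, ?_, TT_add_w' him' u, ?_⟩
    · exact neg_ne_zero.2 (Complex.exp_ne_zero _)
    · beta_reduce
      rw [TT_add_w hw, ← mul_assoc]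
      congr 1
      rw [neg_mul, ← Complex.exp_add, ← mul_neg_one, ← Complex.exp_neg_pi_mul_I, ← Complex.exp_add]
      congr 1
      unfold EE
      field_simp
      ring
  · intro u
    refine ⟨1, one_ne_zero, ?_, ?_⟩
    · have := TT_add_w (w' := w) (neg_ne_zero.2 hw') (u + w')
      rw [add_neg_cancel_right] at this
      rw [one_mul, this]
    · beta_reduce
      rw [TT_add_w' him, ← mul_assoc, one_mul]
      congr 1
      rw [mul_neg, ← Complex.exp_add, ← mul_neg_one, ← Complex.exp_pi_mul_I, ← Complex.exp_add]
      congr 1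
      unfold EE
      field_simp
      ring

/-- Additive shifted product. -/
noncomputable def PP (f : ℂ → ℂ) (o x : ℂ) (n : ℤ) : ℂ :=
  if 0 ≤ n then ∏ j ∈ Finset.range n.toNat, f (x + j * o)
  else ∏ j ∈ Finset.range (-n).toNat, (f (x + (-((j : ℤ) + 1) : ℤ) * o))⁻¹

theorem thetaPoch_eq_PP (w w' o x : ℂ) (n : ℤ) :
    thetaPoch (Complex.exp (2 * (Real.pi : ℂ) * Complex.I * x / w))
      (Complex.exp (2 * (Real.pi : ℂ) * Complex.I * w' / w))
      (Complex.exp (2 * (Real.pi : ℂ) * Complex.I * o / w)) n = PP (TT w w') o x n := by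
  unfold thetaPoch PP TT
  split_ifs with h
  · refine Finset.prod_congr rfl fun j _ => ?_
    rw [← Complex.exp_nat_mul, ← Complex.exp_add]
    congr 2
    ring
  · refine Finset.prod_congr rfl fun j _ => ?_
    rw [← Complex.exp_int_mul, ← Complex.exp_add]
    congr 3
    ring

/-- Sum of the quadratic exponents. -/
noncomputable def SS (w w' o x n : ℂ) : ℂ :=
  (Real.pi : ℂ) * Complex.I * ((n * x ^ 2 + x * o * (n ^ 2 - n) +
    o ^ 2 * (2 * n ^ 3 - 3 * n ^ 2 + n) / 6) / (w * w')
    - (n * x + o * (n ^ 2 - n) / 2) / w - (n * x + o * (n ^ 2 - n) / 2) / w')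

theorem PP_modular {w w' c : ℂ} (hc : c ≠ 0) {f g : ℂ → ℂ}
    (h : ∀ u, f u = c * (Complex.exp (EE w w' u) * g u)) (o x : ℂ) (n : ℤ) :
    PP f o x n = c ^ n * Complex.exp (SS w w' o x n) * PP g o x n := by
  unfold PP
  split_ifs with hn
  · lift n to ℕ using hn
    rw [Int.toNat_natCast]
    induction n with
    | zero => simp [SS]
    | succ k ih =>
      rw [Finset.prod_range_succ, Finset.prod_range_succ, ih, h]
      have : SS w w' o x ((k + 1 : ℕ) : ℤ) = SS w w' o x (k : ℤ) + EE w w' (x + k * o) := by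
        unfold SS EE
        push_cast
        ring
      rw [this, Complex.exp_add, zpow_natCast, zpow_natCast, pow_succ]
      ring
  · obtain ⟨k, rfl⟩ : ∃ k : ℕ, n = -k := ⟨(-n).toNat, by omega⟩
    clear hn
    rw [neg_neg, Int.toNat_natCast]
    induction k with
    | zero => simp [SS]
    | succ k ih =>
      rw [Finset.prod_range_succ, Finset.prod_range_succ, ih, h]
      have : SS w w' o x ((-((k + 1 : ℕ) : ℤ) : ℤ) : ℂ) = SS w w' o x ((-(k : ℤ) : ℤ) : ℂ) -
          EE w w' (x + (-((k : ℤ) + 1) : ℤ) * o) := by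
        unfold SS EE
        push_cast
        ring
      rw [this, Complex.exp_sub, zpow_neg, zpow_neg, zpow_natCast, zpow_natCast, pow_succ, mul_inv,
        mul_inv, mul_inv, div_eq_mul_inv]
      ring

theorem SS_sum {n M : ℕ}
    (m : Fin M → Fin n → ℤ) (ε : Fin M → ℤ)
    (hcube : ∀ i j k : Fin n, ∑ a, ε a * m a i * m a j * m a k = 0)
    (hsq : ∀ i j : Fin n, ∑ a, ε a * m a i * m a j = 0)
    (hlin : ∀ i : Fin n, ∑ a, ε a * m a i = 0)
    (w w' o : ℂ) (i : Fin n) (u : Fin n → ℂ) :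
    ∑ a, (ε a : ℂ) * SS w w' o (∑ j, (m a j : ℂ) * u j) (m a i) = 0 := by
  have c1 : ∀ i, ∑ a, (ε a : ℂ) * m a i = 0 := fun i => by exact_mod_cast hlin i
  have c2 : ∀ i j, ∑ a, (ε a : ℂ) * m a i * m a j = 0 := fun i j => by exact_mod_cast hsq i j
  have c3 : ∀ i j k, ∑ a, (ε a : ℂ) * m a i * m a j * m a k = 0 :=
    fun i j k => by exact_mod_cast hcube i j k
  have x1 : ∑ a, (ε a : ℂ) * m a i * (∑ j, (m a j : ℂ) * u j) = 0 := by
    simp_rw [Finset.mul_sum]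
    rw [Finset.sum_comm]
    refine Finset.sum_eq_zero fun j _ => ?_
    simp_rw [← mul_assoc]
    rw [← Finset.sum_mul, c2, zero_mul]
  have x2 : ∀ k, ∑ a, (ε a : ℂ) * m a i * m a k * (∑ j, (m a j : ℂ) * u j) = 0 := by
    intro k
    simp_rw [Finset.mul_sum]
    rw [Finset.sum_comm]
    refine Finset.sum_eq_zero fun j _ => ?_
    simp_rw [← mul_assoc]
    rw [← Finset.sum_mul, c3, zero_mul]
  have x3 : ∑ a, (ε a : ℂ) * m a i * (∑ j, (m a j : ℂ) * u j) ^ 2 = 0 := by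
    have : ∀ a, (ε a : ℂ) * m a i * (∑ j, (m a j : ℂ) * u j) ^ 2 =
        ∑ k, (ε a : ℂ) * m a i * m a k * (∑ j, (m a j : ℂ) * u j) * u k := by
      intro a
      rw [sq]
      nth_rewrite 1 [Finset.sum_mul]
      rw [Finset.mul_sum]
      refine Finset.sum_congr rfl fun k _ => ?_
      ring
    simp_rw [this]
    rw [Finset.sum_comm]
    refine Finset.sum_eq_zero fun j _ => ?_
    rw [← Finset.sum_mul, x2, zero_mul]
  have key : ∑ a, (ε a : ℂ) * SS w w' o (∑ j, (m a j : ℂ) * u j) (m a i) =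
      (Real.pi : ℂ) * Complex.I / (w * w') *
        (∑ a, (ε a : ℂ) * m a i * (∑ j, (m a j : ℂ) * u j) ^ 2)
      + (Real.pi : ℂ) * Complex.I / (w * w') * o *
        (∑ a, (ε a : ℂ) * m a i * m a i * (∑ j, (m a j : ℂ) * u j))
      + (-(Real.pi : ℂ) * Complex.I / (w * w') * o - (Real.pi : ℂ) * Complex.I / w
          - (Real.pi : ℂ) * Complex.I / w') *
        (∑ a, (ε a : ℂ) * m a i * (∑ j, (m a j : ℂ) * u j))
      + (Real.pi : ℂ) * Complex.I / (w * w') * o ^ 2 / 3 *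
        (∑ a, (ε a : ℂ) * m a i * m a i * m a i)
      + (-(Real.pi : ℂ) * Complex.I / (w * w') * o ^ 2 / 2 - (Real.pi : ℂ) * Complex.I / w * o / 2
          - (Real.pi : ℂ) * Complex.I / w' * o / 2) * (∑ a, (ε a : ℂ) * m a i * m a i)
      + ((Real.pi : ℂ) * Complex.I / (w * w') * o ^ 2 / 6 + (Real.pi : ℂ) * Complex.I / w * o / 2
          + (Real.pi : ℂ) * Complex.I / w' * o / 2) * (∑ a, (ε a : ℂ) * m a i) := by
    simp only [Finset.mul_sum (s := (Finset.univ : Finset (Fin M))), ← Finset.sum_add_distrib]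
    refine Finset.sum_congr rfl fun a _ => ?_
    unfold SS
    generalize (∑ j, (m a j : ℂ) * u j) = x
    ring
  rw [key, x1, x2, x3, c1, c2, c3]
  simp

/-- Modular invariance of the `q`-certificates of a totally elliptic hypergeometric
term (Rains–Spiridonov): under the Diophantine conditions on `m^{(a)}, ε_a`, the
certificate built from the `τ → -1/τ` modular transformed bases equals the
original certificate. -/
theorem certificates_modular_invariance (n M : ℕ) (hn : 1 ≤ n) (hM : 1 ≤ M)
    (m : Fin M → Fin n → ℤ) (ε : Fin M → ℤ)
    (hcube : ∀ i j k : Fin n, ∑ a, ε a * m a i * m a j * m a k = 0)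
    (hsq : ∀ i j : Fin n, ∑ a, ε a * m a i * m a j = 0)
    (hlin : ∀ i : Fin n, ∑ a, ε a * m a i = 0)
    (ω₁ ω₂ ω₃ : ℂ) (hω₁ : ω₁ ≠ 0) (hω₂ : ω₂ ≠ 0) (hω₃ : ω₃ ≠ 0)
    (him : 0 < (ω₃ / ω₂).im)
    (i : Fin n) (u : Fin n → ℂ)
    (hnv : ∀ a : Fin M, ε a * m a i < 0 → ∀ k : ℤ,
      theta (Complex.exp (-(2 * (Real.pi : ℂ) * Complex.I) * (∑ j, (m a j : ℂ) * u j) / ω₃) *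
            Complex.exp (-(2 * (Real.pi : ℂ) * Complex.I) * ω₁ / ω₃) ^ k)
          (Complex.exp (-(2 * (Real.pi : ℂ) * Complex.I) * ω₂ / ω₃)) ≠ 0 ∧
      theta (Complex.exp (2 * (Real.pi : ℂ) * Complex.I * (∑ j, (m a j : ℂ) * u j) / ω₂) *
            Complex.exp (2 * (Real.pi : ℂ) * Complex.I * ω₁ / ω₂) ^ k)
          (Complex.exp (2 * (Real.pi : ℂ) * Complex.I * ω₃ / ω₂)) ≠ 0) :
    ∏ a, thetaPoch
        (Complex.exp (-(2 * (Real.pi : ℂ) * Complex.I) * (∑ j, (m a j : ℂ) * u j) / ω₃))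
        (Complex.exp (-(2 * (Real.pi : ℂ) * Complex.I) * ω₂ / ω₃))
        (Complex.exp (-(2 * (Real.pi : ℂ) * Complex.I) * ω₁ / ω₃)) (m a i) ^ ε a =
    ∏ a, thetaPoch
        (Complex.exp (2 * (Real.pi : ℂ) * Complex.I * (∑ j, (m a j : ℂ) * u j) / ω₂))
        (Complex.exp (2 * (Real.pi : ℂ) * Complex.I * ω₃ / ω₂))
        (Complex.exp (2 * (Real.pi : ℂ) * Complex.I * ω₁ / ω₂)) (m a i) ^ ε a := by
  obtain ⟨c, hc, hmod⟩ := TT_modular hω₂ hω₃ him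
  have hL : ∀ z : ℂ, -(2 * (Real.pi : ℂ) * Complex.I) * z / ω₃ =
      2 * (Real.pi : ℂ) * Complex.I * z / (-ω₃) := by
    intro z
    rw [neg_mul, neg_div, div_neg]
  simp_rw [hL, thetaPoch_eq_PP]
  simp_rw [PP_modular hc hmod, mul_zpow, Finset.prod_mul_distrib]
  have e1 : ∏ a, (c ^ m a i) ^ ε a = 1 := by
    simp_rw [← zpow_mul]
    have : ∀ s : Finset (Fin M), ∏ a ∈ s, c ^ (m a i * ε a) = c ^ (∑ a ∈ s, m a i * ε a) := by
      intro s
      induction s using Finset.cons_induction with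
      | empty => simp
      | cons a s ha ih => rw [Finset.prod_cons, Finset.sum_cons, ih, zpow_add₀ hc]
    rw [this]
    have h0 : ∑ a, m a i * ε a = 0 := by
      rw [← hlin i]
      exact Finset.sum_congr rfl fun a _ => mul_comm _ _
    rw [h0, zpow_zero]
  have e2 : ∏ a, Complex.exp (SS ω₂ ω₃ ω₁ (∑ j, (m a j : ℂ) * u j) (m a i)) ^ ε a = 1 := by
    simp_rw [← Complex.exp_int_mul]
    rw [← Complex.exp_sum, SS_sum m ε hcube hsq hlin, Complex.exp_zero]
  rw [e1, e2, one_mul, one_mul]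
end

section
/- (Jacobi's theorem on triply periodic functions.) Let φ be a meromorphic function on ℂ and let ω₁, ω₂, ω₃ ∈ ℂ be linearly independent over ℤ, i.e. if n₁ω₁ + n₂ω₂ + n₃ω₃ = 0 with n₁, n₂, n₃ ∈ ℤ then n₁ = n₂ = n₃ = 0. If φ(u + ω₁) = φ(u + ω₂) = φ(u + ω₃) = φ(u) for all u ∈ ℂ, then φ is constant. -/
open Filter Topology in
/-- Jacobi's theorem: a meromorphic function on `ℂ` with three periods that are
linearly independent over `ℤ` is constant. -/
theorem jacobi_triply_periodic_constant (φ : ℂ → ℂ)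
    (hφ : ∀ z : ℂ, MeromorphicAt φ z) (ω₁ ω₂ ω₃ : ℂ)
    (hind : ∀ n₁ n₂ n₃ : ℤ,
      (n₁ : ℂ) * ω₁ + (n₂ : ℂ) * ω₂ + (n₃ : ℂ) * ω₃ = 0 → n₁ = 0 ∧ n₂ = 0 ∧ n₃ = 0)
    (h₁ : ∀ u : ℂ, φ (u + ω₁) = φ u)
    (h₂ : ∀ u : ℂ, φ (u + ω₂) = φ u)
    (h₃ : ∀ u : ℂ, φ (u + ω₃) = φ u) :
    ∃ c : ℂ, ∀ u : ℂ, φ u = c := by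
  have hli : LinearIndependent ℤ ![ω₁, ω₂, ω₃] := by
    rw [Fintype.linearIndependent_iff]
    intro g hg
    simp only [Fin.sum_univ_three, zsmul_eq_mul] at hg
    obtain ⟨a, b, c⟩ := hind (g 0) (g 1) (g 2) hg
    intro i
    fin_cases i
    · exact a
    · exact b
    · exact c
  set s : Set ℂ := Set.range ![ω₁, ω₂, ω₃] with hs
  have hper : ∀ w ∈ Submodule.span ℤ s, ∀ u, φ (u + w) = φ u := by
    intro w hw
    induction hw using Submodule.span_induction with
    | mem x hx =>
      obtain ⟨i, rfl⟩ := hx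
      fin_cases i
      · exact h₁
      · exact h₂
      · exact h₃
    | zero => simp
    | add x y _ _ hx hy => intro u; rw [← add_assoc, hy, hx]
    | smul a x _ hx =>
      have hp : Function.Periodic φ x := hx
      exact hp.zsmul a
  have hnd : ¬ DiscreteTopology (Submodule.span ℤ s) := by
    intro hd
    have h := Real.finrank_eq_int_finrank_of_discrete hd
    have h3 : Set.finrank ℤ s = 3 := by
      have := finrank_span_eq_card hli
      simpa [Set.finrank] using this
    have h2 : Set.finrank ℝ s ≤ 2 := by
      have := Submodule.finrank_le (Submodule.span ℝ s)
      rwa [Complex.finrank_real_complex] at this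
    omega
  have hsmall : ∀ ε > 0, ∃ w ∈ Submodule.span ℤ s, w ≠ 0 ∧ ‖w‖ < ε := by
    by_contra! hcon
    obtain ⟨ε, hε, hc⟩ := hcon
    apply hnd
    rw [discreteTopology_iff_isOpen_singleton_zero, Metric.isOpen_singleton_iff]
    refine ⟨ε, hε, fun y hy => ?_⟩
    by_contra hne
    have h := hc y.1 y.2 (by simpa using hne)
    rw [dist_zero_right] at hy
    exact absurd hy (not_lt.mpr h)
  have hloc : IsLocallyConstant φ := by
    rw [IsLocallyConstant.iff_eventually_eq]
    intro z
    have hm : MeromorphicAt (fun x => φ x - φ z) z := (hφ z).sub (MeromorphicAt.const _ _)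
    rcases hm.eventually_eq_zero_or_eventually_ne_zero with h | h
    · rw [eventually_nhdsWithin_iff] at h
      filter_upwards [h] with y hy
      by_cases hyz : y = z
      · rw [hyz]
      · exact sub_eq_zero.mp (hy hyz)
    · exfalso
      rw [eventually_nhdsWithin_iff, Metric.eventually_nhds_iff] at h
      obtain ⟨ε, hε, h⟩ := h
      obtain ⟨w, hw, hw0, hwε⟩ := hsmall ε hε
      refine h (y := z + w) (by simpa using hwε) (by simpa using hw0) ?_
      rw [hper w hw, sub_self]
  exact ⟨φ 0, fun u => hloc.apply_eq_of_isPreconnected isPreconnected_univ trivial trivial⟩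
end
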